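/- arXiv:math/0206214 — 2 statements merged into one kernel-verified Lean document; each statement's English description precedes it below -/
import Mathlib

section
/- Let a, b ∈ 𝔻 be distinct and let z = (z₁,z₂) ∈ 𝔻² satisfy log|z₂| > log|φ_a(z₁)| + log|φ_b(z₁)|. Then liminf_{ε→0, ε≠0} L^ε_{a0bV}(z) ≥ min{ L_{a0b0}(z), L_{a0bV}(z) }, where the liminf is over complex ε ≠ 0 tending to 0. -/
open Complex Metric Filter Topology

noncomputable section

/-- The open unit disc in `ℂ`. -/
def unitDisc : Set ℂ := Metric.ball 0 1

/-- Extended-real logarithm, with the convention `log 0 = ⊥`. -/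
def elog (x : ℝ) : EReal := if x = 0 then ⊥ else ((Real.log x : ℝ) : EReal)

/-- The Möbius involution of the unit disc exchanging `ξ` and `0`. -/
def mobius (ξ ζ : ℂ) : ℂ := (ξ - ζ) / (1 - (starRingEnd ℂ) ξ * ζ)

/-- An analytic disc in the bidisc `𝔻²`, given by its two components. -/
def AnalyticDisc2 (φ₁ φ₂ : ℂ → ℂ) : Prop :=
  DifferentiableOn ℂ φ₁ unitDisc ∧ DifferentiableOn ℂ φ₂ unitDisc ∧
  (∀ w ∈ unitDisc, φ₁ w ∈ unitDisc) ∧ (∀ w ∈ unitDisc, φ₂ w ∈ unitDisc)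

/-- The Lempert function with the two simple poles `(a,0)`, `(b,0)` in the bidisc. -/
def La0b0 (a b : ℂ) (z : ℂ × ℂ) : EReal :=
  sInf { t : EReal | ∃ (φ₁ φ₂ : ℂ → ℂ) (ζ₁ ζ₂ : ℂ),
    AnalyticDisc2 φ₁ φ₂ ∧ ζ₁ ∈ unitDisc ∧ ζ₂ ∈ unitDisc ∧
    φ₁ 0 = z.1 ∧ φ₂ 0 = z.2 ∧
    φ₁ ζ₁ = a ∧ φ₂ ζ₁ = 0 ∧ φ₁ ζ₂ = b ∧ φ₂ ζ₂ = 0 ∧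
    t = elog ‖ζ₁‖ + elog ‖ζ₂‖ }

/-- The generalized Lempert function with vertical indicator at `(a,0)` and
simple pole `(b,0)`. -/
def LaVb0 (a b : ℂ) (z : ℂ × ℂ) : EReal :=
  sInf { t : EReal | ∃ (φ₁ φ₂ : ℂ → ℂ) (ζ₁ ζ₂ : ℂ),
    AnalyticDisc2 φ₁ φ₂ ∧ ζ₁ ∈ unitDisc ∧ ζ₂ ∈ unitDisc ∧
    φ₁ 0 = z.1 ∧ φ₂ 0 = z.2 ∧
    φ₁ ζ₁ = a ∧ φ₂ ζ₁ = 0 ∧ φ₁ ζ₂ = b ∧ φ₂ ζ₂ = 0 ∧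
    deriv φ₁ ζ₁ = 0 ∧
    t = elog ‖ζ₁‖ + elog ‖ζ₁‖ + elog ‖ζ₂‖ }

/-- The generalized Lempert function with simple pole `(a,0)` and vertical
indicator at `(b,0)`. -/
def La0bV (a b : ℂ) (z : ℂ × ℂ) : EReal :=
  sInf { t : EReal | ∃ (φ₁ φ₂ : ℂ → ℂ) (ζ₁ ζ₂ : ℂ),
    AnalyticDisc2 φ₁ φ₂ ∧ ζ₁ ∈ unitDisc ∧ ζ₂ ∈ unitDisc ∧
    φ₁ 0 = z.1 ∧ φ₂ 0 = z.2 ∧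
    φ₁ ζ₁ = a ∧ φ₂ ζ₁ = 0 ∧ φ₁ ζ₂ = b ∧ φ₂ ζ₂ = 0 ∧
    deriv φ₁ ζ₂ = 0 ∧
    t = elog ‖ζ₁‖ + elog ‖ζ₂‖ + elog ‖ζ₂‖ }

/-- The generalized Lempert function with vertical indicators at `(a,0)` and `(b,0)`. -/
def LaVbV (a b : ℂ) (z : ℂ × ℂ) : EReal :=
  sInf { t : EReal | ∃ (φ₁ φ₂ : ℂ → ℂ) (ζ₁ ζ₂ : ℂ),
    AnalyticDisc2 φ₁ φ₂ ∧ ζ₁ ∈ unitDisc ∧ ζ₂ ∈ unitDisc ∧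
    φ₁ 0 = z.1 ∧ φ₂ 0 = z.2 ∧
    φ₁ ζ₁ = a ∧ φ₂ ζ₁ = 0 ∧ φ₁ ζ₂ = b ∧ φ₂ ζ₂ = 0 ∧
    deriv φ₁ ζ₁ = 0 ∧ deriv φ₁ ζ₂ = 0 ∧
    t = elog ‖ζ₁‖ + elog ‖ζ₁‖
        + elog ‖ζ₂‖ + elog ‖ζ₂‖ }

/-- Coman's Lempert function with the three simple poles `(a,0)`, `(b,0)`, `(b,ε)`. -/
def Leps3 (a b ε : ℂ) (z : ℂ × ℂ) : EReal :=
  sInf { t : EReal | ∃ (φ₁ φ₂ : ℂ → ℂ) (ζ₁ ζ₂ ζ₃ : ℂ),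
    AnalyticDisc2 φ₁ φ₂ ∧ ζ₁ ∈ unitDisc ∧ ζ₂ ∈ unitDisc ∧ ζ₃ ∈ unitDisc ∧
    φ₁ 0 = z.1 ∧ φ₂ 0 = z.2 ∧
    φ₁ ζ₁ = a ∧ φ₂ ζ₁ = 0 ∧ φ₁ ζ₂ = b ∧ φ₂ ζ₂ = 0 ∧ φ₁ ζ₃ = b ∧ φ₂ ζ₃ = ε ∧
    t = elog ‖ζ₁‖ + elog ‖ζ₂‖ + elog ‖ζ₃‖ }

/-- Coman's Lempert function with the four simple poles
`(a,0)`, `(b,0)`, `(b,ε)`, `(a,ε)`. -/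
def Leps4 (a b ε : ℂ) (z : ℂ × ℂ) : EReal :=
  sInf { t : EReal | ∃ (φ₁ φ₂ : ℂ → ℂ) (ζ₁ ζ₂ ζ₃ ζ₄ : ℂ),
    AnalyticDisc2 φ₁ φ₂ ∧ ζ₁ ∈ unitDisc ∧ ζ₂ ∈ unitDisc ∧ ζ₃ ∈ unitDisc ∧ ζ₄ ∈ unitDisc ∧
    φ₁ 0 = z.1 ∧ φ₂ 0 = z.2 ∧
    φ₁ ζ₁ = a ∧ φ₂ ζ₁ = 0 ∧ φ₁ ζ₂ = b ∧ φ₂ ζ₂ = 0 ∧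
    φ₁ ζ₃ = b ∧ φ₂ ζ₃ = ε ∧ φ₁ ζ₄ = a ∧ φ₂ ζ₄ = ε ∧
    t = elog ‖ζ₁‖ + elog ‖ζ₂‖
        + elog ‖ζ₃‖ + elog ‖ζ₄‖ }

theorem mem_uD {w : ℂ} : w ∈ unitDisc ↔ ‖w‖ < 1 := by simp [unitDisc]

theorem uD_open : IsOpen unitDisc := Metric.isOpen_ball

theorem mob_id (p w : ℂ) :
    ‖1 - (starRingEnd ℂ) p * w‖ ^ 2 - ‖p - w‖ ^ 2 = (1 - ‖p‖ ^ 2) * (1 - ‖w‖ ^ 2) := by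
  simp only [← Complex.normSq_eq_norm_sq, Complex.normSq_apply]
  simp
  ring

theorem mob_den {p w : ℂ} (hp : ‖p‖ < 1) (hw : ‖w‖ ≤ 1) : 1 - (starRingEnd ℂ) p * w ≠ 0 := by
  intro h
  have h1 : (starRingEnd ℂ) p * w = 1 := (sub_eq_zero.mp h).symm
  have h2 : ‖p‖ * ‖w‖ = 1 := by
    have := congrArg norm h1
    simpa using this
  nlinarith [norm_nonneg p, norm_nonneg w]

theorem mob_num_lt {p w : ℂ} (hp : ‖p‖ < 1) (hw : ‖w‖ < 1) :
    ‖p - w‖ < ‖1 - (starRingEnd ℂ) p * w‖ := by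
  have h := mob_id p w
  have h1 : 0 < (1 - ‖p‖ ^ 2) * (1 - ‖w‖ ^ 2) := by
    apply mul_pos <;> nlinarith [norm_nonneg p, norm_nonneg w]
  exact lt_of_pow_lt_pow_left₀ 2 (norm_nonneg _) (by linarith)

theorem mob_num_le {p w : ℂ} (hp : ‖p‖ ≤ 1) (hw : ‖w‖ ≤ 1) :
    ‖p - w‖ ≤ ‖1 - (starRingEnd ℂ) p * w‖ := by
  have h := mob_id p w
  have h1 : 0 ≤ (1 - ‖p‖ ^ 2) * (1 - ‖w‖ ^ 2) := by
    apply mul_nonneg <;> nlinarith [norm_nonneg p, norm_nonneg w]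
  exact le_of_sq_le_sq (by linarith) (norm_nonneg _)

theorem mob_lt {p w : ℂ} (hp : ‖p‖ < 1) (hw : ‖w‖ < 1) : ‖mobius p w‖ < 1 := by
  rw [mobius, norm_div, div_lt_one (norm_pos_iff.mpr (mob_den hp hw.le))]
  exact mob_num_lt hp hw

theorem mob_le {p w : ℂ} (hp : ‖p‖ < 1) (hw : ‖w‖ ≤ 1) : ‖mobius p w‖ ≤ 1 := by
  rw [mobius, norm_div, div_le_one (norm_pos_iff.mpr (mob_den hp hw))]
  exact mob_num_le hp.le hw

theorem mob_mob {p w : ℂ} (hp : ‖p‖ < 1) (hw : ‖w‖ ≤ 1) : mobius p (mobius p w) = w := by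
  have h1 := mob_den hp hw
  have h2 := mob_den hp (mob_le hp hw)
  have e : mobius p w * (1 - (starRingEnd ℂ) p * w) = p - w := div_mul_cancel₀ _ h1
  rw [mobius, div_eq_iff h2]
  apply mul_right_cancel₀ h1
  linear_combination (-1 + w * (starRingEnd ℂ) p) * e

theorem mob_symm (p w : ℂ) : ‖mobius p w‖ = ‖mobius w p‖ := by
  rw [mobius, mobius, norm_div, norm_div, norm_sub_rev]
  congr 1
  rw [← Complex.norm_conj]
  simp [mul_comm]

theorem mob_self (p : ℂ) : mobius p p = 0 := by simp [mobius]
theorem mob_zero (p : ℂ) : mobius p 0 = p := by simp [mobius]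
theorem mob_zero_left (p : ℂ) : ‖mobius 0 p‖ = ‖p‖ := by simp [mobius]

theorem mob_ne {p w : ℂ} (hp : ‖p‖ < 1) (hw : ‖w‖ ≤ 1) (h : p ≠ w) : mobius p w ≠ 0 :=
  div_ne_zero (sub_ne_zero.mpr h) (mob_den hp hw)

theorem mob_diffAt {p w : ℂ} (hp : ‖p‖ < 1) (hw : ‖w‖ ≤ 1) : DifferentiableAt ℂ (mobius p) w := by
  have h := mob_den hp hw
  unfold mobius
  fun_prop (disch := assumption)

theorem mob_diff {p : ℂ} (hp : ‖p‖ < 1) : DifferentiableOn ℂ (mobius p) unitDisc := fun _ hw =>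
  (mob_diffAt hp (mem_uD.mp hw).le).differentiableWithinAt

/-- Schur class. -/
def Sch (g : ℂ → ℂ) : Prop := DifferentiableOn ℂ g unitDisc ∧ ∀ w ∈ unitDisc, ‖g w‖ ≤ 1

theorem Sch.mob {g : ℂ → ℂ} (hg : Sch g) {p : ℂ} (hp : ‖p‖ < 1) :
    Sch (fun w => mobius p (g w)) := by
  refine ⟨fun w hw => ?_, fun w hw => mob_le hp (hg.2 w hw)⟩
  exact (mob_diffAt hp (hg.2 w hw)).comp_differentiableWithinAt w (hg.1 w hw)

theorem Sch.factor {f : ℂ → ℂ} (hf : Sch f) {p : ℂ} (hp : ‖p‖ < 1) (h0 : f p = 0) :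
    ∃ g, Sch g ∧ ∀ w ∈ unitDisc, f w = mobius p w * g w := by
  have hm : Set.MapsTo (mobius p) unitDisc unitDisc := fun w hw =>
    mem_uD.mpr (mob_lt hp (mem_uD.mp hw))
  set F : ℂ → ℂ := fun w => f (mobius p w) with hF
  have hFd : DifferentiableOn ℂ F unitDisc := hf.1.comp (mob_diff hp) hm
  have hF0 : F 0 = 0 := by simp [hF, mob_zero, h0]
  have hd : DifferentiableOn ℂ (dslope F 0) unitDisc :=
    (Complex.differentiableOn_dslope (uD_open.mem_nhds (by simp [mem_uD]))).mpr hFd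
  refine ⟨fun w => dslope F 0 (mobius p w), ⟨hd.comp (mob_diff hp) hm, fun w hw => ?_⟩, ?_⟩
  · have := Complex.norm_dslope_le_div_of_mapsTo_ball (f := F) (c := 0) (R₁ := 1) (R₂ := 1)
      (z := mobius p w) hFd (fun x hx => by
        rw [hF0]; simpa using hf.2 _ (hm hx)) (hm hw)
    simpa using this
  · intro w hw
    have := sub_smul_dslope F 0 (mobius p w)
    rw [hF0] at this
    simp only [sub_zero, smul_eq_mul] at this
    rw [this]
    simp only [hF]
    rw [mob_mob hp (mem_uD.mp hw).le]

theorem Sch.pick {g : ℂ → ℂ} (hg : Sch g) {q : ℂ} (hq : ‖q‖ < 1) :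
    ‖g 0 - g q‖ ≤ ‖q‖ * ‖1 - (starRingEnd ℂ) (g 0) * g q‖ := by
  have h0 : (0 : ℂ) ∈ unitDisc := by simp [mem_uD]
  rcases (hg.2 0 h0).lt_or_eq with h | h
  · have hF := hg.mob h
    obtain ⟨k, hk, hk'⟩ := hF.factor (p := 0) (by simp) (mob_self _)
    have h1 := hk' q (mem_uD.mpr hq)
    have h2 : ‖mobius (g 0) (g q)‖ ≤ ‖q‖ := by
      rw [h1, norm_mul, mob_zero_left]
      exact mul_le_of_le_one_right (norm_nonneg _) (hk.2 q (mem_uD.mpr hq))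
    rwa [mobius, norm_div, div_le_iff₀ (norm_pos_iff.mpr
      (mob_den h (hg.2 q (mem_uD.mpr hq))))] at h2
  · have := Complex.eqOn_of_isPreconnected_of_isMaxOn_norm
      (convex_ball (0 : ℂ) 1).isPreconnected uD_open hg.1 h0 (fun w hw => by
        simpa [h] using hg.2 w hw)
    have h1 := this (mem_uD.mpr hq)
    simp only [Function.const] at h1
    rw [h1]; simp; positivity

/-- Two point Pick interpolation. -/
theorem exists_pick {p q w0 w1 : ℂ} (hp : ‖p‖ < 1) (hq : ‖q‖ < 1) (hpq : p ≠ q)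
    (h0 : ‖w0‖ ≤ 1) (h1 : ‖w1‖ ≤ 1)
    (h : ‖w0 - w1‖ ≤ ‖mobius p q‖ * ‖1 - (starRingEnd ℂ) w0 * w1‖) :
    ∃ g, Sch g ∧ g p = w0 ∧ g q = w1 := by
  have hne := mob_ne hp hq.le hpq
  rcases h0.lt_or_eq with h0 | h0
  · have hc : ‖mobius w0 w1 / mobius p q‖ ≤ 1 := by
      rw [norm_div, div_le_one (norm_pos_iff.mpr hne), mobius, norm_div,
        div_le_iff₀ (norm_pos_iff.mpr (mob_den h0 h1))]
      exact h
    refine ⟨fun w => mobius w0 (mobius w0 w1 / mobius p q * mobius p w), Sch.mob ⟨?_, ?_⟩ h0, ?_, ?_⟩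
    · exact (mob_diff hp).const_mul _
    · intro w hw
      rw [norm_mul]
      exact mul_le_one₀ hc (norm_nonneg _) (mob_le hp (mem_uD.mp hw).le)
    · simp [mob_self, mob_zero]
    · simp only []
      rw [div_mul_cancel₀ _ hne, mob_mob h0 h1]
  · have hw : w0 = w1 := by
      by_contra hne'
      have e : ‖1 - (starRingEnd ℂ) w0 * w1‖ = ‖w0 - w1‖ := by
        have := mob_id w0 w1
        rw [h0] at this
        have : ‖1 - (starRingEnd ℂ) w0 * w1‖ ^ 2 = ‖w0 - w1‖ ^ 2 := by linarith
        exact (pow_left_inj₀ (norm_nonneg _) (norm_nonneg _) two_ne_zero).mp this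
      rw [e] at h
      have h3 := mob_lt hp hq
      have h4 : 0 < ‖w0 - w1‖ := norm_pos_iff.mpr (sub_ne_zero.mpr hne')
      nlinarith
    exact ⟨fun _ => w0, ⟨differentiableOn_const _, fun _ _ => h0.le⟩, rfl, hw⟩

theorem elog_mul {x y : ℝ} (hx : x ≠ 0) (hy : y ≠ 0) : elog x + elog y = elog (x * y) := by
  simp only [elog, hx, hy, mul_ne_zero hx hy, if_false]
  rw [Real.log_mul hx hy, EReal.coe_add]

theorem elog_le_coe {x c : ℝ} (hx : 0 < x) : elog x ≤ (c : EReal) ↔ x ≤ Real.exp c := by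
  simp only [elog, hx.ne', if_false, EReal.coe_le_coe_iff]
  exact Real.log_le_iff_le_exp hx

theorem elog_lt_coe {x c : ℝ} (hx : 0 < x) : elog x < (c : EReal) ↔ x < Real.exp c := by
  simp only [elog, hx.ne', if_false, EReal.coe_lt_coe_iff]
  exact Real.log_lt_iff_lt_exp hx

theorem exists_phi2 {z2 ζ₁ ζ₂ : ℂ} (h1 : ‖ζ₁‖ < 1) (h2 : ‖ζ₂‖ < 1) (hz : z2 ≠ 0)
    (h : ‖z2‖ ≤ ‖ζ₁‖ * ‖ζ₂‖) :
    ∃ φ : ℂ → ℂ, DifferentiableOn ℂ φ unitDisc ∧ (∀ w ∈ unitDisc, φ w ∈ unitDisc) ∧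
      φ 0 = z2 ∧ φ ζ₁ = 0 ∧ φ ζ₂ = 0 := by
  have hz' : 0 < ‖z2‖ := norm_pos_iff.mpr hz
  have hn1 : ζ₁ ≠ 0 := by rintro rfl; simp at h; exact hz h
  have hn2 : ζ₂ ≠ 0 := by rintro rfl; simp at h; exact hz h
  refine ⟨fun w => z2 / (ζ₁ * ζ₂) * (mobius ζ₁ w * mobius ζ₂ w), ?_, ?_, ?_, ?_, ?_⟩
  · exact ((mob_diff h1).mul (mob_diff h2)).const_mul _
  · intro w hw
    rw [mem_uD] at hw ⊢
    rw [norm_mul, norm_mul, norm_div, norm_mul]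
    have e1 : ‖z2‖ / (‖ζ₁‖ * ‖ζ₂‖) ≤ 1 := div_le_one_of_le₀ h (by positivity)
    have e2 := mob_lt h1 hw
    have e3 := mob_lt h2 hw
    have e4 : ‖mobius ζ₁ w‖ * ‖mobius ζ₂ w‖ < 1 :=
      mul_lt_one_of_nonneg_of_lt_one_left (norm_nonneg _) e2 e3.le
    exact mul_lt_one_of_nonneg_of_lt_one_right e1 (by positivity) e4
  · simp only [mob_zero]; field_simp
  · simp [mob_self]
  · simp [mob_self]

theorem La0b0_symm (a b : ℂ) (z : ℂ × ℂ) : La0b0 a b z ≤ La0b0 b a z := by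
  refine le_sInf ?_
  rintro t ⟨φ₁, φ₂, ζ₁, ζ₂, h, h1, h2, h3, h4, h5, h6, h7, h8, rfl⟩
  exact sInf_le ⟨φ₁, φ₂, ζ₂, ζ₁, h, h2, h1, h3, h4, h7, h8, h5, h6, add_comm _ _⟩

theorem La0b0_le_of {a b : ℂ} {z : ℂ × ℂ} (ha : ‖a‖ < 1) (hb : ‖b‖ < 1) (hz1 : ‖z.1‖ < 1)
    (hz2 : z.2 ≠ 0) {ζ₁ ζ₂ : ℂ} (h1 : ‖ζ₁‖ < 1) (h2 : ‖ζ₂‖ < 1)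
    (h : ‖z.2‖ = ‖ζ₁‖ * ‖ζ₂‖) {g : ℂ → ℂ} (hg : Sch g)
    (hg1 : ζ₁ * g ζ₁ = mobius z.1 a) (hg2 : ζ₂ * g ζ₂ = mobius z.1 b) :
    La0b0 a b z ≤ elog ‖z.2‖ := by
  have hz' : 0 < ‖z.2‖ := norm_pos_iff.mpr hz2
  have hn1 : ζ₁ ≠ 0 := by rintro rfl; simp at h; exact hz2 h
  have hn2 : ζ₂ ≠ 0 := by rintro rfl; simp at h; exact hz2 h
  obtain ⟨φ₂, d2, m2, e0, e1, e2⟩ := exists_phi2 h1 h2 hz2 h.le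
  have hlt : ∀ w ∈ unitDisc, ‖w * g w‖ < 1 := fun w hw => by
    rw [norm_mul]
    exact mul_lt_one_of_nonneg_of_lt_one_left (norm_nonneg _) (mem_uD.mp hw) (hg.2 w hw)
  have hs : Sch (fun w => w * g w) :=
    ⟨differentiableOn_id.mul hg.1, fun w hw => (hlt w hw).le⟩
  refine sInf_le ⟨fun w => mobius z.1 (w * g w), φ₂, ζ₁, ζ₂,
    ⟨(hs.mob hz1).1, d2, fun w hw => mem_uD.mpr (mob_lt hz1 (hlt w hw)), m2⟩,
    mem_uD.mpr h1, mem_uD.mpr h2, ?_, e0, ?_, e1, ?_, e2, ?_⟩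
  · simp [mob_zero]
  · simp only [hg1]; exact mob_mob hz1 ha.le
  · simp only [hg2]; exact mob_mob hz1 hb.le
  · rw [elog_mul (norm_ne_zero_iff.mpr hn1) (norm_ne_zero_iff.mpr hn2), h]

theorem La0b0_le_aux {a b : ℂ} {z : ℂ × ℂ} (ha : ‖a‖ < 1) (hb : ‖b‖ < 1)
    (hz1 : ‖z.1‖ < 1) (hz2 : z.2 ≠ 0) (hz2' : ‖z.2‖ < 1)
    (hc : ‖mobius z.1 a‖ * ‖mobius z.1 b‖ < ‖z.2‖) (hle : ‖mobius z.1 a‖ ≤ ‖mobius z.1 b‖) :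
    La0b0 a b z ≤ elog ‖z.2‖ := by
  set α := mobius z.1 a with hα
  set β := mobius z.1 b with hβ
  have hα1 : ‖α‖ < 1 := mob_lt hz1 ha
  have hβ1 : ‖β‖ < 1 := mob_lt hz1 hb
  have hz' : 0 < ‖z.2‖ := norm_pos_iff.mpr hz2
  rcases lt_or_ge (‖z.2‖ * ‖β‖) ‖α‖ with hcase | hcase
  · have hα0 : 0 < ‖α‖ := lt_of_le_of_lt (by positivity) hcase
    have hβ0 : 0 < ‖β‖ := hα0.trans_le hle
    set r := Real.sqrt (‖α‖ * ‖β‖ / ‖z.2‖) with hr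
    have hr2 : r ^ 2 = ‖α‖ * ‖β‖ / ‖z.2‖ := Real.sq_sqrt (by positivity)
    have hr0 : 0 < r := Real.sqrt_pos.mpr (by positivity)
    have hr1 : r < 1 := by
      rw [hr, Real.sqrt_lt' one_pos, one_pow, div_lt_one hz']; exact hc
    have hβr : ‖β‖ < r := by
      apply Real.lt_sqrt_of_sq_lt
      rw [lt_div_iff₀ hz']
      nlinarith
    have hrn : ‖(r : ℂ)‖ = r := by simp [abs_of_pos hr0]
    have hrc : (r : ℂ) ≠ 0 := by exact_mod_cast hr0.ne'
    refine La0b0_le_of (ζ₁ := α / r) (ζ₂ := β / r) (g := fun _ => (r : ℂ)) ha hb hz1 hz2 ?_ ?_ ?_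
      ⟨differentiableOn_const _, fun _ _ => by rw [hrn]; exact hr1.le⟩ ?_ ?_
    · rw [norm_div, hrn, div_lt_one hr0]; linarith
    · rw [norm_div, hrn, div_lt_one hr0]; linarith
    · rw [norm_div, norm_div, hrn, div_mul_div_comm, ← sq, hr2]
      field_simp
    · exact div_mul_cancel₀ _ hrc
    · exact div_mul_cancel₀ _ hrc
  · set t := ‖z.2‖ with ht
    have hw : ‖α / t‖ < 1 := by
      rw [norm_div, Complex.norm_real, Real.norm_of_nonneg hz'.le, div_lt_one hz']
      nlinarith
    -- the strict inequality at s = 1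
    have hlim : ∀ᶠ s : ℝ in 𝓝 1,
        ‖α * s / t - β / s‖ * ‖1 - (starRingEnd ℂ) ((t / s : ℝ) : ℂ) * (s : ℂ)‖ <
        ‖((t / s : ℝ) : ℂ) - (s : ℂ)‖ * ‖1 - (starRingEnd ℂ) (α * s / t) * (β / s)‖ := by
      refine ContinuousAt.eventually_lt ?_ ?_ ?_
      · have : ContinuousAt (fun s : ℝ => (s : ℂ)) 1 := by fun_prop
        have h1 : ContinuousAt (fun s : ℝ => t / s) 1 := continuousAt_const.div continuousAt_id one_ne_zero
        have h2 : ContinuousAt (fun s : ℝ => β / (s : ℂ)) 1 := continuousAt_const.div this (by simp)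
        fun_prop
      · have : ContinuousAt (fun s : ℝ => (s : ℂ)) 1 := by fun_prop
        have h1 : ContinuousAt (fun s : ℝ => t / s) 1 := continuousAt_const.div continuousAt_id one_ne_zero
        have h2 : ContinuousAt (fun s : ℝ => β / (s : ℂ)) 1 := continuousAt_const.div this (by simp)
        fun_prop
      · have h1 := mob_num_lt hw hβ1
        have h2 : 0 < ‖(1 : ℂ) - (t : ℂ)‖ := norm_pos_iff.mpr (sub_ne_zero.mpr (by
          intro h; have : (1 : ℝ) = t := by exact_mod_cast h
          linarith))
        have := mul_lt_mul_of_pos_right h1 h2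
        simpa [norm_sub_rev, mul_comm] using this
    have hlim2 : ∀ᶠ s : ℝ in 𝓝 1, t < s ∧ ‖β‖ < s :=
      (lt_mem_nhds hz2').and (lt_mem_nhds hβ1)
    obtain ⟨s, ⟨⟨hs1, hs2, hs3⟩, hs4⟩⟩ :=
      (((hlim.and hlim2).filter_mono (nhdsWithin_le_nhds (s := Set.Iio 1))).and
        self_mem_nhdsWithin).exists
    have hs4 : s < 1 := hs4
    have hs0 : 0 < s := hz'.trans hs2
    have hsc : (s : ℂ) ≠ 0 := by exact_mod_cast hs0.ne'
    have htc : (t : ℂ) ≠ 0 := by exact_mod_cast hz'.ne'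
    have hn1 : ‖((t / s : ℝ) : ℂ)‖ = t / s := by
      rw [Complex.norm_real, Real.norm_of_nonneg (by positivity)]
    have hn2 : ‖(s : ℂ)‖ = s := by rw [Complex.norm_real, Real.norm_of_nonneg hs0.le]
    have hl1 : ‖((t / s : ℝ) : ℂ)‖ < 1 := by rw [hn1, div_lt_one hs0]; exact hs2
    have hl2 : ‖(s : ℂ)‖ < 1 := by rw [hn2]; exact hs4
    have hd := norm_pos_iff.mpr (mob_den hl1 hl2.le)
    have hne : ((t / s : ℝ) : ℂ) ≠ (s : ℂ) := by
      intro h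
      rw [h] at hs1
      simp only [sub_self, norm_zero, zero_mul] at hs1
      exact absurd hs1 (not_lt.mpr (by positivity))
    obtain ⟨g, hg, g1, g2⟩ := exists_pick (w0 := α * s / t) (w1 := β / s) hl1 hl2 hne (by
        rw [norm_div, norm_mul, hn2, Complex.norm_real, Real.norm_of_nonneg hz'.le,
          div_le_one hz']
        nlinarith [norm_nonneg α, norm_nonneg β]) (by
        rw [norm_div, hn2, div_le_one hs0]; exact hs3.le) (by
        rw [mobius, norm_div, div_mul_eq_mul_div, le_div_iff₀ hd]
        exact hs1.le)
    refine La0b0_le_of ha hb hz1 hz2 hl1 hl2 ?_ hg ?_ ?_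
    · rw [hn1, hn2, div_mul_cancel₀ _ hs0.ne']
    · rw [g1]; push_cast; field_simp; exact hα
    · rw [g2]; field_simp; exact hβ

theorem La0b0_le {a b : ℂ} {z : ℂ × ℂ} (ha : ‖a‖ < 1) (hb : ‖b‖ < 1)
    (hz1 : ‖z.1‖ < 1) (hz2 : z.2 ≠ 0) (hz2' : ‖z.2‖ < 1)
    (hc : ‖mobius a z.1‖ * ‖mobius b z.1‖ < ‖z.2‖) :
    La0b0 a b z ≤ elog ‖z.2‖ := by
  rw [mob_symm a, mob_symm b] at hc
  rcases le_total ‖mobius z.1 a‖ ‖mobius z.1 b‖ with h | h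
  · exact La0b0_le_aux ha hb hz1 hz2 hz2' hc h
  · exact (La0b0_symm _ _ _).trans (La0b0_le_aux hb ha hz1 hz2 hz2' (by rwa [mul_comm]) h)

theorem La0bV_le {a b : ℂ} {z : ℂ × ℂ} (ha : ‖a‖ < 1) (hb : ‖b‖ < 1) (hab : a ≠ b)
    (hz1 : ‖z.1‖ < 1) (hz2 : z.2 ≠ 0) {ζ ω : ℂ} (h1 : ‖ζ‖ < 1) (h2 : ‖ω‖ < 1)
    (h : ‖z.2‖ ≤ ‖ζ‖ * ‖ω‖) (hw0 : ‖mobius b z.1‖ ≤ ‖ω‖ ^ 2)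
    (hw1 : ‖mobius b a‖ ≤ ‖mobius ω ζ‖ ^ 2)
    (hp : ‖mobius b z.1 / ω ^ 2 - mobius b a / mobius ω ζ ^ 2‖ ≤
      ‖ζ‖ * ‖1 - (starRingEnd ℂ) (mobius b z.1 / ω ^ 2) * (mobius b a / mobius ω ζ ^ 2)‖) :
    La0bV a b z ≤ elog (‖ζ‖ * ‖ω‖ * ‖ω‖) := by
  have hn1 : ζ ≠ 0 := by rintro rfl; simp at h; exact hz2 h
  have hn2 : ω ≠ 0 := by rintro rfl; simp at h; exact hz2 h
  have hm : mobius ω ζ ≠ 0 := by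
    intro h0
    rw [h0] at hw1
    have := norm_pos_iff.mpr (mob_ne hb ha.le hab.symm)
    simp at hw1
    simp [hw1] at this
  obtain ⟨φ₂, d2, m2, e0, e1, e2⟩ := exists_phi2 h1 h2 hz2 h
  obtain ⟨g, hg, g0, g1⟩ := exists_pick (p := 0) (q := ζ) (w0 := mobius b z.1 / ω ^ 2)
    (w1 := mobius b a / mobius ω ζ ^ 2) (by simp) h1 hn1.symm
    (by rw [norm_div, norm_pow]; exact div_le_one_of_le₀ hw0 (by positivity))
    (by rw [norm_div, norm_pow]; exact div_le_one_of_le₀ hw1 (by positivity))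
    (by rw [mob_zero_left]; exact hp)
  have hlt : ∀ w ∈ unitDisc, ‖mobius ω w ^ 2 * g w‖ < 1 := fun w hw => by
    rw [norm_mul, norm_pow]
    exact mul_lt_one_of_nonneg_of_lt_one_left (by positivity)
      (pow_lt_one₀ (norm_nonneg _) (mob_lt h2 (mem_uD.mp hw)) two_ne_zero) (hg.2 w hw)
  have hs : Sch (fun w => mobius ω w ^ 2 * g w) :=
    ⟨((mob_diff h2).pow 2).mul hg.1, fun w hw => (hlt w hw).le⟩
  refine sInf_le ⟨fun w => mobius b (mobius ω w ^ 2 * g w), φ₂, ζ, ω,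
    ⟨(hs.mob hb).1, d2, fun w hw => mem_uD.mpr (mob_lt hb (hlt w hw)), m2⟩,
    mem_uD.mpr h1, mem_uD.mpr h2, ?_, e0, ?_, e1, ?_, e2, ?_, ?_⟩
  · simp only [mob_zero, g0]
    rw [mul_div_cancel₀ _ (pow_ne_zero 2 hn2)]
    exact mob_mob hb hz1.le
  · simp only [g1]
    rw [mul_div_cancel₀ _ (pow_ne_zero 2 hm)]
    exact mob_mob hb ha.le
  · simp [mob_self, mob_zero]
  · have hd1 : DifferentiableAt ℂ (mobius ω) ω := mob_diffAt h2 h2.le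
    have hd2 : DifferentiableAt ℂ g ω := (hg.1 ω (mem_uD.mpr h2)).differentiableAt
      (uD_open.mem_nhds (mem_uD.mpr h2))
    have hD : HasDerivAt (fun w => mobius ω w ^ 2 * g w) 0 ω := by
      have := (hd1.hasDerivAt.pow 2).mul hd2.hasDerivAt
      exact this.congr_deriv (by simp [mob_self])
    have hE : HasDerivAt (mobius b) (deriv (mobius b) (mobius ω ω ^ 2 * g ω))
      (mobius ω ω ^ 2 * g ω) := (mob_diffAt hb (by simp [mob_self])).hasDerivAt
    have := (hE.comp ω hD).deriv
    rw [mul_zero] at this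
    exact this
  · have := norm_ne_zero_iff.mpr hn1
    have := norm_ne_zero_iff.mpr hn2
    rw [elog_mul, elog_mul] <;> first | assumption | (apply mul_ne_zero <;> assumption)

theorem disc_facts {a b ε : ℂ} {z : ℂ × ℂ} (hb : ‖b‖ < 1) (hab : a ≠ b)
    (hε : ε ≠ 0) (hz2 : z.2 ≠ 0) (hεz : ε ≠ z.2) {φ₁ φ₂ : ℂ → ℂ} {ζ₁ ζ₂ ζ₃ : ℂ}
    (hφ : AnalyticDisc2 φ₁ φ₂) (h1 : ‖ζ₁‖ < 1) (h2 : ‖ζ₂‖ < 1) (h3 : ‖ζ₃‖ < 1)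
    (e1 : φ₁ 0 = z.1) (e2 : φ₂ 0 = z.2) (e3 : φ₁ ζ₁ = a) (e4 : φ₂ ζ₁ = 0)
    (e5 : φ₁ ζ₂ = b) (e6 : φ₂ ζ₂ = 0) (e7 : φ₁ ζ₃ = b) (e8 : φ₂ ζ₃ = ε) :
    ‖z.2‖ ≤ ‖ζ₁‖ * ‖ζ₂‖ ∧
    ‖z.2‖ * (‖mobius b a‖ * ‖mobius ζ₂ ζ₃‖) ≤
      ‖ζ₁‖ * ‖ζ₂‖ * ‖ζ₃‖ * (‖mobius b a‖ * ‖mobius ζ₂ ζ₃‖) + 2 * ‖ε‖ ∧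
    ‖mobius b z.1‖ ≤ ‖ζ₂‖ * ‖ζ₃‖ ∧
    ‖mobius b a‖ ≤ ‖mobius ζ₂ ζ₁‖ * ‖mobius ζ₃ ζ₁‖ ∧
    ‖mobius b z.1 / (ζ₂ * ζ₃) - mobius b a / (mobius ζ₂ ζ₁ * mobius ζ₃ ζ₁)‖ ≤
      ‖ζ₁‖ * ‖1 - (starRingEnd ℂ) (mobius b z.1 / (ζ₂ * ζ₃)) *
        (mobius b a / (mobius ζ₂ ζ₁ * mobius ζ₃ ζ₁))‖ := by
  obtain ⟨d1, d2, m1, m2⟩ := hφ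
  have u0 : (0 : ℂ) ∈ unitDisc := by simp [mem_uD]
  have u1 := mem_uD.mpr h1
  have u2 := mem_uD.mpr h2
  have u3 := mem_uD.mpr h3
  have n12 : ζ₁ ≠ ζ₂ := by rintro rfl; exact hab (e3.symm.trans e5)
  have n13 : ζ₁ ≠ ζ₃ := by rintro rfl; exact hab (e3.symm.trans e7)
  have n23 : ζ₂ ≠ ζ₃ := by rintro rfl; exact hε (e8.symm.trans e6)
  have S1 : Sch φ₁ := ⟨d1, fun w hw => (mem_uD.mp (m1 w hw)).le⟩
  have S2 : Sch φ₂ := ⟨d2, fun w hw => (mem_uD.mp (m2 w hw)).le⟩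
  obtain ⟨g, hg, hg'⟩ := S2.factor h1 e4
  have hgz : g ζ₂ = 0 := by
    have := hg' ζ₂ u2
    rw [e6, eq_comm, mul_eq_zero] at this
    exact this.resolve_left (mob_ne h1 h2.le n12)
  obtain ⟨k, hk, hk'⟩ := hg.factor h2 hgz
  have hk2 : ∀ w ∈ unitDisc, φ₂ w = mobius ζ₁ w * mobius ζ₂ w * k w := fun w hw => by
    rw [hg' w hw, hk' w hw, mul_assoc]
  obtain ⟨p, hp, hp'⟩ := (S1.mob hb).factor h2 (by simp only [e5, mob_self])
  have hpz : p ζ₃ = 0 := by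
    have := hp' ζ₃ u3
    simp only [e7, mob_self] at this
    rw [eq_comm, mul_eq_zero] at this
    exact this.resolve_left (mob_ne h2 h3.le n23)
  obtain ⟨q, hq, hq'⟩ := hp.factor h3 hpz
  have hq2 : ∀ w ∈ unitDisc, mobius b (φ₁ w) = mobius ζ₂ w * mobius ζ₃ w * q w := fun w hw => by
    have := hp' w hw
    rw [this, hq' w hw, mul_assoc]
  have k0 := hk2 0 u0
  rw [e2, mob_zero, mob_zero] at k0
  have k3 := hk2 ζ₃ u3
  rw [e8] at k3
  have q0 := hq2 0 u0
  rw [e1, mob_zero, mob_zero] at q0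
  have q1 := hq2 ζ₁ u1
  rw [e3] at q1
  have A1 : ‖z.2‖ ≤ ‖ζ₁‖ * ‖ζ₂‖ := by
    rw [k0, norm_mul, norm_mul]
    exact mul_le_of_le_one_right (by positivity) (hk.2 0 u0)
  have A4 : ‖mobius b a‖ ≤ ‖mobius ζ₂ ζ₁‖ * ‖mobius ζ₃ ζ₁‖ := by
    rw [q1, norm_mul, norm_mul]
    exact mul_le_of_le_one_right (by positivity) (hq.2 ζ₁ u1)
  refine ⟨A1, ?_, ?_, A4, ?_⟩
  · have A5 : ‖mobius b a‖ ≤ ‖mobius ζ₁ ζ₃‖ := by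
      rw [mob_symm ζ₁]
      exact A4.trans (mul_le_of_le_one_left (norm_nonneg _) (mob_lt h2 h1).le)
    have P := hk.pick h3
    have hk3 : ‖1 - (starRingEnd ℂ) (k 0) * k ζ₃‖ ≤ 1 + ‖k ζ₃‖ := by
      refine (norm_sub_le _ _).trans ?_
      rw [norm_mul, norm_one, Complex.norm_conj]
      have := mul_le_of_le_one_left (norm_nonneg (k ζ₃)) (hk.2 0 u0)
      linarith
    have hk0 : ‖k 0‖ ≤ ‖ζ₃‖ + 2 * ‖k ζ₃‖ := by
      have t1 : ‖k 0‖ ≤ ‖k 0 - k ζ₃‖ + ‖k ζ₃‖ := by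
        simpa using norm_add_le (k 0 - k ζ₃) (k ζ₃)
      have t2 := mul_le_mul_of_nonneg_left hk3 (norm_nonneg ζ₃)
      nlinarith [norm_nonneg (k ζ₃), norm_nonneg ζ₃]
    have hεn : ‖mobius b a‖ * ‖mobius ζ₂ ζ₃‖ * ‖k ζ₃‖ ≤ ‖ε‖ := by
      rw [k3, norm_mul, norm_mul]
      gcongr
    set D := ‖mobius b a‖ * ‖mobius ζ₂ ζ₃‖ with hD
    have hD0 : 0 ≤ D := by positivity
    have hz : ‖z.2‖ = ‖ζ₁‖ * ‖ζ₂‖ * ‖k 0‖ := by rw [k0, norm_mul, norm_mul]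
    have hR : ‖ζ₁‖ * ‖ζ₂‖ ≤ 1 := mul_le_one₀ h1.le (norm_nonneg _) h2.le
    have hR0 : 0 ≤ ‖ζ₁‖ * ‖ζ₂‖ := by positivity
    calc ‖z.2‖ * D = ‖ζ₁‖ * ‖ζ₂‖ * D * ‖k 0‖ := by rw [hz]; ring
      _ ≤ ‖ζ₁‖ * ‖ζ₂‖ * D * (‖ζ₃‖ + 2 * ‖k ζ₃‖) := by gcongr
      _ = ‖ζ₁‖ * ‖ζ₂‖ * ‖ζ₃‖ * D + 2 * ((‖ζ₁‖ * ‖ζ₂‖) * (D * ‖k ζ₃‖)) := by ring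
      _ ≤ ‖ζ₁‖ * ‖ζ₂‖ * ‖ζ₃‖ * D + 2 * (1 * ‖ε‖) := by gcongr
      _ = _ := by ring
  · rw [q0, norm_mul, norm_mul]
    exact mul_le_of_le_one_right (by positivity) (hq.2 0 u0)
  · have n2 : ζ₂ ≠ 0 := by rintro rfl; exact hz2 (e2.symm.trans e6)
    have n3 : ζ₃ ≠ 0 := by rintro rfl; exact hεz (e8.symm.trans e2)
    have m2 := mob_ne h2 h1.le n12.symm
    have m3 := mob_ne h3 h1.le n13.symm
    rw [q0, q1, mul_div_cancel_left₀ _ (mul_ne_zero n2 n3),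
      mul_div_cancel_left₀ _ (mul_ne_zero m2 m3)]
    exact hq.pick h1

theorem La0bV_le_bdry {a b : ℂ} {z : ℂ × ℂ} (ha : ‖a‖ < 1) (hb : ‖b‖ < 1) (hab : a ≠ b)
    (hz1 : ‖z.1‖ < 1) (hz2 : z.2 ≠ 0) {ω : ℂ} (h2 : ‖ω‖ < 1)
    (h : ‖z.2‖ ≤ ‖ω‖) (hw0 : ‖mobius b z.1‖ ≤ ‖ω‖ ^ 2) {c : ℝ} (hc : ‖ω‖ ^ 2 < Real.exp c) :
    La0bV a b z ≤ (c : EReal) := by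
  have hω : 0 < ‖ω‖ := (norm_pos_iff.mpr hz2).trans_le h
  obtain ⟨ω', hω1, hω2, hω3⟩ : ∃ ω' : ℂ, ‖ω‖ < ‖ω'‖ ∧ ‖ω'‖ < 1 ∧ ‖ω'‖ ^ 2 < Real.exp c := by
    have hl : ∀ᶠ t : ℝ in 𝓝 1, t * ‖ω‖ < 1 ∧ (t * ‖ω‖) ^ 2 < Real.exp c := by
      refine Filter.Eventually.and ?_ ?_
      · exact ContinuousAt.eventually_lt (by fun_prop) (by fun_prop) (by simpa using h2)
      · exact ContinuousAt.eventually_lt (by fun_prop) (by fun_prop) (by simpa using hc)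
    obtain ⟨t, ⟨ht1, ht2⟩, ht⟩ := ((hl.filter_mono (nhdsWithin_le_nhds (s := Set.Ioi 1))).and
        self_mem_nhdsWithin).exists
    have ht : 1 < t := ht
    have e : ‖(t : ℂ) * ω‖ = t * ‖ω‖ := by
      rw [norm_mul, Complex.norm_real, Real.norm_of_nonneg (by linarith)]
    exact ⟨t * ω, by rw [e]; nlinarith, by rw [e]; exact ht1, by rw [e]; exact ht2⟩
  have hω' : 0 < ‖ω'‖ := hω.trans hω1
  have hba : ‖mobius b a‖ < 1 := mob_lt hb ha
  have hm1 : ‖mobius ω' 1‖ = 1 := by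
    have hd := norm_pos_iff.mpr (mob_den (w := 1) hω2 (by simp))
    rw [mobius, norm_div, div_eq_one_iff_eq hd.ne']
    have := mob_id ω' 1
    simp only [norm_one] at this
    exact ((pow_left_inj₀ (norm_nonneg _) (norm_nonneg _) two_ne_zero).mp (by linarith)).symm
  have hm1' : mobius ω' 1 ^ 2 ≠ 0 := by
    apply pow_ne_zero; rw [← norm_ne_zero_iff, hm1]; exact one_ne_zero
  have hcs : ContinuousAt (fun s : ℝ => (s : ℂ)) 1 := by fun_prop
  have hcm : ContinuousAt (fun s : ℝ => mobius ω' (s : ℂ)) 1 := by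
    have h' : ContinuousAt (mobius ω') ((1 : ℝ) : ℂ) := (mob_diffAt hω2 (by simp)).continuousAt
    exact ContinuousAt.comp (f := fun s : ℝ => (s : ℂ)) h' hcs
  have hcd : ContinuousAt (fun s : ℝ => mobius b a / mobius ω' (s : ℂ) ^ 2) 1 :=
    continuousAt_const.div (hcm.pow 2) (by simpa using hm1')
  have hev : ∀ᶠ s : ℝ in 𝓝 1, 0 < s ∧ ‖z.2‖ < ‖(s : ℂ)‖ * ‖ω'‖ ∧
      ‖mobius b a‖ < ‖mobius ω' s‖ ^ 2 ∧
      ‖mobius b z.1 / ω' ^ 2 - mobius b a / mobius ω' s ^ 2‖ <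
      ‖(s : ℂ)‖ * ‖1 - (starRingEnd ℂ) (mobius b z.1 / ω' ^ 2) *
        (mobius b a / mobius ω' s ^ 2)‖ := by
    refine (lt_mem_nhds one_pos).and (Filter.Eventually.and ?_ (Filter.Eventually.and ?_ ?_))
    · exact ContinuousAt.eventually_lt (by fun_prop) (by fun_prop) (by simpa using h.trans_lt hω1)
    · exact ContinuousAt.eventually_lt (by fun_prop) (by fun_prop) (by simpa [hm1] using hba)
    · refine ContinuousAt.eventually_lt (by fun_prop) (by fun_prop) ?_
      simp only [Complex.ofReal_one, norm_one, one_mul]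
      apply mob_num_lt
      · rw [norm_div, norm_pow, div_lt_one (by positivity)]
        exact hw0.trans_lt (by gcongr)
      · rw [norm_div, norm_pow, hm1]; simpa using hba
  obtain ⟨s, ⟨hs0, hs1, hs2, hs3⟩, hs⟩ := ((hev.filter_mono
    (nhdsWithin_le_nhds (s := Set.Iio 1))).and self_mem_nhdsWithin).exists
  have hs : s < 1 := hs
  have hsn : ‖(s : ℂ)‖ = s := by rw [Complex.norm_real, Real.norm_of_nonneg hs0.le]
  have hfin := La0bV_le ha hb hab hz1 hz2 (by rw [hsn]; exact hs) hω2 hs1.le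
    (hw0.trans (by gcongr)) hs2.le hs3.le
  refine hfin.trans ((elog_le_coe (by rw [hsn]; positivity)).mpr ?_)
  rw [hsn]
  nlinarith [sq_nonneg ‖ω'‖]

theorem Leps3_facts {a b ε : ℂ} {z : ℂ × ℂ} (hb : ‖b‖ < 1) (hab : a ≠ b)
    (hε : ε ≠ 0) (hz2 : z.2 ≠ 0) (hεz : ε ≠ z.2) {c : ℝ} (hL : Leps3 a b ε z < (c : EReal)) :
    ∃ x : ℂ × ℂ × ℂ × ℝ, ‖x.1‖ < 1 ∧ ‖x.2.1‖ < 1 ∧ ‖x.2.2.1‖ < 1 ∧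
    x.2.2.2 = ‖mobius x.2.1 x.2.2.1‖ ∧
    ‖x.1‖ * ‖x.2.1‖ * ‖x.2.2.1‖ ≤ Real.exp c ∧
    ‖z.2‖ ≤ ‖x.1‖ * ‖x.2.1‖ ∧
    ‖z.2‖ * (‖mobius b a‖ * x.2.2.2) ≤
      ‖x.1‖ * ‖x.2.1‖ * ‖x.2.2.1‖ * (‖mobius b a‖ * x.2.2.2) + 2 * ‖ε‖ ∧
    ‖mobius b z.1‖ ≤ ‖x.2.1‖ * ‖x.2.2.1‖ ∧
    ‖mobius b a‖ ≤ ‖mobius x.2.1 x.1‖ * ‖mobius x.2.2.1 x.1‖ ∧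
    ‖mobius b z.1 / (x.2.1 * x.2.2.1) - mobius b a / (mobius x.2.1 x.1 * mobius x.2.2.1 x.1)‖ ≤
      ‖x.1‖ * ‖1 - (starRingEnd ℂ) (mobius b z.1 / (x.2.1 * x.2.2.1)) *
        (mobius b a / (mobius x.2.1 x.1 * mobius x.2.2.1 x.1))‖ := by
  obtain ⟨t, ⟨φ₁, φ₂, ζ₁, ζ₂, ζ₃, hφ, h1, h2, h3, e1, e2, e3, e4, e5, e6, e7, e8, rfl⟩, ht⟩ :=
    sInf_lt_iff.mp hL
  rw [mem_uD] at h1 h2 h3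
  have n1 : ζ₁ ≠ 0 := by rintro rfl; exact hz2 (e2.symm.trans e4)
  have n2 : ζ₂ ≠ 0 := by rintro rfl; exact hz2 (e2.symm.trans e6)
  have n3 : ζ₃ ≠ 0 := by rintro rfl; exact hεz (e8.symm.trans e2)
  have p1 := norm_pos_iff.mpr n1
  have p2 := norm_pos_iff.mpr n2
  have p3 := norm_pos_iff.mpr n3
  have hf := disc_facts hb hab hε hz2 hεz hφ h1 h2 h3 e1 e2 e3 e4 e5 e6 e7 e8
  refine ⟨(ζ₁, ζ₂, ζ₃, ‖mobius ζ₂ ζ₃‖), h1, h2, h3, rfl, ?_, hf⟩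
  rw [elog_mul p1.ne' p2.ne', elog_mul (by positivity) p3.ne'] at ht
  exact ((elog_lt_coe (by positivity)).mp ht).le

set_option maxHeartbeats 2000000

/-- Lemma `liminf`: if `log|z₂| > log|φ_a(z₁)| + log|φ_b(z₁)|`, then
`liminf_{ε→0, ε≠0} L^ε_{a0bV}(z) ≥ min {L_{a0b0}(z), L_{a0bV}(z)}`. -/
theorem liminf_Leps3_ge
    (a b : ℂ) (ha : a ∈ unitDisc) (hb : b ∈ unitDisc) (hab : a ≠ b)
    (z : ℂ × ℂ) (hz1 : z.1 ∈ unitDisc) (hz2 : z.2 ∈ unitDisc)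
    (hcond : elog ‖mobius a z.1‖ + elog ‖mobius b z.1‖
      < elog ‖z.2‖) :
    min (La0b0 a b z) (La0bV a b z)
      ≤ Filter.liminf (fun ε => Leps3 a b ε z) (𝓝[≠] (0 : ℂ)) := by
  rw [mem_uD] at ha hb hz1 hz2
  have hz0 : z.2 ≠ 0 := by
    intro h
    rw [h] at hcond
    simp [elog] at hcond
  have hzp : 0 < ‖z.2‖ := norm_pos_iff.mpr hz0
  have hc : ‖mobius a z.1‖ * ‖mobius b z.1‖ < ‖z.2‖ := by
    by_cases h1 : ‖mobius a z.1‖ = 0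
    · rw [h1, zero_mul]; exact hzp
    by_cases h2 : ‖mobius b z.1‖ = 0
    · rw [h2, mul_zero]; exact hzp
    rw [elog_mul h1 h2] at hcond
    have h3 : elog ‖z.2‖ = ((Real.log ‖z.2‖ : ℝ) : EReal) := by simp [elog, hz0]
    rw [h3, elog_lt_coe (by positivity), Real.exp_log hzp] at hcond
    exact hcond
  have hA := La0b0_le ha hb hz1 hz0 hz2 hc
  by_contra hcon
  rw [not_le] at hcon
  obtain ⟨c, hc1, hc2⟩ := EReal.lt_iff_exists_real_btwn.mp hcon
  obtain ⟨c', hc3, hc4⟩ := EReal.lt_iff_exists_real_btwn.mp hc2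
  have hcc : c < c' := by exact_mod_cast hc3
  have hM0 : (c : EReal) < La0b0 a b z := hc2.trans_le (min_le_left _ _)
  have hMV : (c' : EReal) < La0bV a b z := hc4.trans_le (min_le_right _ _)
  -- key contradiction
  have hkey : Real.exp c < ‖z.2‖ := by
    by_contra hlt
    exact absurd (hA.trans ((elog_le_coe hzp).mpr (not_lt.mp hlt))) (not_le.mpr hM0)
  have hfreq : ∃ᶠ ε in 𝓝[≠] (0 : ℂ), Leps3 a b ε z < (c : EReal) :=
    frequently_lt_of_liminf_lt (by isBoundedDefault) hc1
  have hev : ∀ᶠ ε in 𝓝[≠] (0 : ℂ), ε ≠ 0 ∧ ε ≠ z.2 :=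
    (eventually_mem_nhdsWithin (s := {(0 : ℂ)}ᶜ)).and
      ((isOpen_ne.mem_nhds hz0.symm : {w : ℂ | w ≠ z.2} ∈ 𝓝 0) |> mem_nhdsWithin_of_mem_nhds)
  obtain ⟨ε, hε, hεP⟩ := exists_seq_forall_of_frequently (hfreq.and_eventually hev)
  have hε0 : Tendsto ε atTop (𝓝 0) := hε.mono_right nhdsWithin_le_nhds
  choose x hx using fun n => Leps3_facts hb hab (hεP n).2.1 hz0 (hεP n).2.2 (hεP n).1
  have hxK : ∀ n, x n ∈ Metric.closedBall (0 : ℂ × ℂ × ℂ × ℝ) 1 := by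
    intro n
    obtain ⟨h1, h2, h3, h4, -⟩ := hx n
    have h5 := mob_lt h2 h3
    rw [mem_closedBall_zero_iff]
    simp only [Prod.norm_def, sup_le_iff]
    refine ⟨h1.le, h2.le, h3.le, ?_⟩
    rw [h4, norm_norm]; exact h5.le
  obtain ⟨y, hy, ψ, hψ, hlim⟩ := (isCompact_closedBall (0 : ℂ × ℂ × ℂ × ℝ) 1).tendsto_subseq hxK
  have hεψ : Tendsto (fun n => ε (ψ n)) atTop (𝓝 0) := hε0.comp hψ.tendsto_atTop
  have L1 : Tendsto (fun n => (x (ψ n)).1) atTop (𝓝 y.1) :=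
    (continuous_fst.tendsto y).comp hlim
  have L2 : Tendsto (fun n => (x (ψ n)).2.1) atTop (𝓝 y.2.1) :=
    ((continuous_fst.comp continuous_snd).tendsto y).comp hlim
  have L3 : Tendsto (fun n => (x (ψ n)).2.2.1) atTop (𝓝 y.2.2.1) :=
    ((continuous_fst.comp (continuous_snd.comp continuous_snd)).tendsto y).comp hlim
  have L4 : Tendsto (fun n => (x (ψ n)).2.2.2) atTop (𝓝 y.2.2.2) :=
    ((continuous_snd.comp (continuous_snd.comp continuous_snd)).tendsto y).comp hlim
  obtain ⟨ζ, ω, ω₃, d⟩ := y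
  simp only at L1 L2 L3 L4
  have B1 : ‖ζ‖ ≤ 1 := le_of_tendsto' L1.norm fun n => (hx _).1.le
  have B2 : ‖ω‖ ≤ 1 := le_of_tendsto' L2.norm fun n => (hx _).2.1.le
  have F1 : ‖ζ‖ * ‖ω‖ * ‖ω₃‖ ≤ Real.exp c :=
    le_of_tendsto' ((L1.norm.mul L2.norm).mul L3.norm) fun n => (hx _).2.2.2.2.1
  have F2 : ‖z.2‖ ≤ ‖ζ‖ * ‖ω‖ :=
    ge_of_tendsto' (L1.norm.mul L2.norm) fun n => (hx _).2.2.2.2.2.1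
  have F3 : ‖z.2‖ * (‖mobius b a‖ * d) ≤ ‖ζ‖ * ‖ω‖ * ‖ω₃‖ * (‖mobius b a‖ * d) := by
    have := le_of_tendsto_of_tendsto' ((L4.const_mul ‖mobius b a‖).const_mul ‖z.2‖)
      ((((L1.norm.mul L2.norm).mul L3.norm).mul (L4.const_mul ‖mobius b a‖)).add
        (hεψ.norm.const_mul 2)) fun n => (hx (ψ n)).2.2.2.2.2.2.1
    simpa using this
  have F4 : ‖mobius b z.1‖ ≤ ‖ω‖ * ‖ω₃‖ :=
    ge_of_tendsto' (L2.norm.mul L3.norm) fun n => (hx _).2.2.2.2.2.2.2.1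
  have hba : 0 < ‖mobius b a‖ := norm_pos_iff.mpr (mob_ne hb ha.le hab.symm)
  have hd0 : 0 ≤ d := ge_of_tendsto' L4 fun n => by
    rw [(hx _).2.2.2.1]; exact norm_nonneg _
  rcases hd0.lt_or_eq with hd | hd
  · have := le_of_mul_le_mul_right F3 (mul_pos hba hd)
    linarith
  have hωω : ω = ω₃ := by
    have h1 : Tendsto (fun n => ‖(x (ψ n)).2.1 - (x (ψ n)).2.2.1‖) atTop (𝓝 ‖ω - ω₃‖) :=
      (L2.sub L3).norm
    have h2 : ‖ω - ω₃‖ ≤ d * 2 := by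
      refine le_of_tendsto_of_tendsto' h1 (L4.mul_const 2) fun n => ?_
      obtain ⟨-, g2, g3, g4, -⟩ := hx (ψ n)
      rw [g4, mobius, norm_div, div_mul_eq_mul_div,
        le_div_iff₀ (norm_pos_iff.mpr (mob_den g2 g3.le))]
      refine mul_le_mul_of_nonneg_left ?_ (norm_nonneg _)
      refine (norm_sub_le _ _).trans ?_
      rw [norm_mul, norm_one, Complex.norm_conj]
      nlinarith [norm_nonneg (x (ψ n)).2.1, norm_nonneg (x (ψ n)).2.2.1]
    rw [← hd, zero_mul] at h2
    exact sub_eq_zero.mp (norm_le_zero_iff.mp h2)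
  subst hωω
  rcases B2.lt_or_eq with hω | hω
  swap
  · rw [hω] at F1 F2; linarith
  have hω0 : 0 < ‖ω‖ := by
    rcases (norm_nonneg ω).lt_or_eq with h | h
    · exact h
    · rw [← h] at F2; linarith
  rcases B1.lt_or_eq with hζ | hζ
  · have M : ContinuousAt (fun v : ℂ × ℂ => mobius v.1 v.2) (ω, ζ) := by
      have := mob_den hω hζ.le
      unfold mobius
      refine ContinuousAt.div (by fun_prop) ?_ this
      have : Continuous (fun v : ℂ × ℂ => 1 - (starRingEnd ℂ) v.1 * v.2) := by fun_prop
      exact this.continuousAt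
    have M2 : Tendsto (fun n => mobius (x (ψ n)).2.1 (x (ψ n)).1) atTop (𝓝 (mobius ω ζ)) :=
      M.tendsto.comp (L2.prodMk_nhds L1)
    have M3 : Tendsto (fun n => mobius (x (ψ n)).2.2.1 (x (ψ n)).1) atTop (𝓝 (mobius ω ζ)) :=
      M.tendsto.comp (L3.prodMk_nhds L1)
    have F5 : ‖mobius b a‖ ≤ ‖mobius ω ζ‖ * ‖mobius ω ζ‖ :=
      ge_of_tendsto' (M2.norm.mul M3.norm) fun n => (hx _).2.2.2.2.2.2.2.2.1
    have hm : mobius ω ζ ≠ 0 := by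
      intro h
      rw [h] at F5
      simp only [norm_zero, mul_zero] at F5
      linarith
    have W0 : Tendsto (fun n => mobius b z.1 / ((x (ψ n)).2.1 * (x (ψ n)).2.2.1)) atTop
        (𝓝 (mobius b z.1 / (ω * ω))) :=
      tendsto_const_nhds.div (L2.mul L3) (mul_ne_zero (norm_pos_iff.mp hω0) (norm_pos_iff.mp hω0))
    have W1 : Tendsto (fun n => mobius b a /
        (mobius (x (ψ n)).2.1 (x (ψ n)).1 * mobius (x (ψ n)).2.2.1 (x (ψ n)).1)) atTop
        (𝓝 (mobius b a / (mobius ω ζ * mobius ω ζ))) :=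
      tendsto_const_nhds.div (M2.mul M3) (mul_ne_zero hm hm)
    have W2 := (Complex.continuous_conj.tendsto _).comp W0
    have F6 := le_of_tendsto_of_tendsto' (W0.sub W1).norm
      (L1.norm.mul ((W2.mul W1).const_sub 1).norm) fun n => (hx (ψ n)).2.2.2.2.2.2.2.2.2
    have hfin := La0bV_le ha hb hab hz1 hz0 hζ hω F2 (by rw [sq]; exact F4) (by rw [sq]; exact F5)
      (by rw [sq, sq]; exact F6)
    have hζ0 : 0 < ‖ζ‖ := by
      rcases (norm_nonneg ζ).lt_or_eq with h | h
      · exact h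
      · rw [← h] at F2; linarith
    have := hfin.trans ((elog_le_coe (by positivity)).mpr F1)
    exact absurd this (not_le.mpr (hc3.trans hMV))
  · rw [hζ, one_mul] at F1 F2
    have := La0bV_le_bdry (c := c') ha hb hab hz1 hz0 hω F2 (by rw [sq]; exact F4)
      (by rw [sq]; exact F1.trans_lt (Real.exp_lt_exp.mpr hcc))
    exact absurd this (not_le.mpr hMV)
end
end

section
/- Let a ∈ (0,1) be real and let γ ∈ ℂ satisfy 0 < |γ| ≤ a^{3/2}. Then there exist an analytic disc φ = (φ₁, φ₂) in 𝔻² and points ζ₁, ζ₂, ζ₄ ∈ 𝔻 such that φ(0) = (0, γ), φ(ζ₁) = (a, 0), φ(ζ₄) = (a, 0), φ(ζ₂) = (−a, 0), φ₁′(ζ₂) = 0, and log|ζ₁| + log|ζ₄| + 2·log|ζ₂| = 2·log a. -/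
open Complex Metric Filter Topology

noncomputable section

/-- Real-parameter Möbius map. -/
def mb (p : ℝ) (z : ℂ) : ℂ := ((p : ℂ) - z) / (1 - p * z)

lemma mb_den {p : ℝ} (hp : |p| < 1) {z : ℂ} (hz : ‖z‖ < 1) : (1 - (p : ℂ) * z) ≠ 0 := by
  intro h
  have h1 : (p : ℂ) * z = 1 := by linear_combination -h
  have h2 : |p| * ‖z‖ = 1 := by
    have := congrArg norm h1
    simpa using this
  nlinarith [abs_nonneg p, norm_nonneg z]

lemma mb_lt {p : ℝ} (hp : |p| < 1) {z : ℂ} (hz : ‖z‖ < 1) : ‖mb p z‖ < 1 := by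
  have hd := mb_den hp hz
  unfold mb
  rw [norm_div, div_lt_one (norm_pos_iff.mpr hd)]
  apply lt_of_pow_lt_pow_left₀ 2 (norm_nonneg _)
  rw [Complex.sq_norm, Complex.sq_norm]
  have h1 : ‖z‖ ^ 2 < 1 := by nlinarith [norm_nonneg z]
  rw [Complex.sq_norm] at h1
  have h2 : p ^ 2 < 1 := by rwa [sq_lt_one_iff_abs_lt_one]
  simp only [Complex.normSq_apply] at *
  simp
  nlinarith [mul_pos (sub_pos.mpr h1) (sub_pos.mpr h2)]

lemma mb_diff {p : ℝ} (hp : |p| < 1) {z : ℂ} (hz : ‖z‖ < 1) : DifferentiableAt ℂ (mb p) z := by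
  have hd := mb_den hp hz
  unfold mb
  exact DifferentiableAt.div (by fun_prop) (by fun_prop) hd

lemma mb_self (p : ℝ) : mb p p = 0 := by simp [mb]

lemma mb_zero (p : ℝ) : mb p 0 = p := by simp [mb]

lemma mb_real (p q : ℝ) : mb p q = (((p - q) / (1 - p * q) : ℝ) : ℂ) := by
  simp [mb]

lemma mb_mb {p q : ℝ} (hp : |p| < 1) (hq : |q| < 1) :
    mb p (((p - q) / (1 - p * q) : ℝ) : ℂ) = q := by
  rw [mb_real]
  have hpq : |p * q| < 1 := by
    rw [abs_mul]; nlinarith [abs_nonneg p, abs_nonneg q]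
  have h1 : 1 - p * q ≠ 0 := by
    have := (abs_lt.mp hpq).2
    linarith
  have h2 : p ^ 2 < 1 := by rwa [sq_lt_one_iff_abs_lt_one]
  have h3 : 1 - p * ((p - q) / (1 - p * q)) ≠ 0 := by
    have : 1 - p * ((p - q) / (1 - p * q)) = (1 - p ^ 2) / (1 - p * q) := by
      field_simp; ring
    rw [this]
    exact div_ne_zero (by linarith) h1
  congr 1
  rw [div_eq_iff h3]
  field_simp
  ring

/-- Step 1 of Theorem `limell4<ltilde`: for real `a ∈ (0,1)` and `0 < |γ| ≤ a^{3/2}`,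
there is an analytic disc `φ` in the bidisc through `(0,γ)`, `(a,0)` (twice) and `(-a,0)`
with a critical point of `φ₁` at the preimage of `(-a,0)`, whose logarithmic sum of
preimages equals `2 log a`. -/
theorem exists_special_disc
    (a : ℝ) (ha0 : 0 < a) (ha1 : a < 1) (γ : ℂ) (hγ0 : γ ≠ 0)
    (hγ : ‖γ‖ ≤ a ^ ((3 : ℝ) / 2)) :
    ∃ (φ₁ φ₂ : ℂ → ℂ) (ζ₁ ζ₂ ζ₄ : ℂ),
      AnalyticDisc2 φ₁ φ₂ ∧ ζ₁ ∈ unitDisc ∧ ζ₂ ∈ unitDisc ∧ ζ₄ ∈ unitDisc ∧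
      φ₁ 0 = 0 ∧ φ₂ 0 = γ ∧
      φ₁ ζ₁ = (a : ℂ) ∧ φ₂ ζ₁ = 0 ∧
      φ₁ ζ₄ = (a : ℂ) ∧ φ₂ ζ₄ = 0 ∧
      φ₁ ζ₂ = (-a : ℂ) ∧ φ₂ ζ₂ = 0 ∧
      deriv φ₁ ζ₂ = 0 ∧
      elog ‖ζ₁‖ + elog ‖ζ₄‖
          + elog ‖ζ₂‖ + elog ‖ζ₂‖
        = ((2 * Real.log a : ℝ) : EReal) := by
  set r := Real.sqrt a with hr
  have hr0 : 0 < r := Real.sqrt_pos.mpr ha0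
  have hr2 : r ^ 2 = a := Real.sq_sqrt ha0.le
  have hr1 : r < 1 := by nlinarith
  have hra : |r| < 1 := by rwa [abs_of_pos hr0]
  have haa : |a| < 1 := by rwa [abs_of_pos ha0]
  set s := Real.sqrt (2 * a / (1 + a ^ 2)) with hs
  have hq0 : 0 < 2 * a / (1 + a ^ 2) := by positivity
  have hs0 : 0 < s := Real.sqrt_pos.mpr hq0
  have hs2 : s ^ 2 = 2 * a / (1 + a ^ 2) := Real.sq_sqrt hq0.le
  have hq1 : 2 * a / (1 + a ^ 2) < 1 := by
    rw [div_lt_one (by positivity)]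
    nlinarith [sq_pos_of_pos (sub_pos.mpr ha1)]
  have hs1 : s < 1 := by nlinarith
  have hsa : |s| < 1 := by rwa [abs_of_pos hs0]
  have hsn : |-s| < 1 := by rwa [abs_neg]
  have hrs : r * s < 1 := by nlinarith
  set u : ℝ := (r - s) / (1 - r * s) with hu
  set v : ℝ := (r - -s) / (1 - r * -s) with hv
  have huv : u * v = -a := by
    have e1 : u * v = (r ^ 2 - s ^ 2) / (1 - r ^ 2 * s ^ 2) := by
      rw [hu, hv, div_mul_div_comm]
      congr 1 <;> ring
    have e2 : 1 - a * (2 * a / (1 + a ^ 2)) = (1 - a ^ 2) / (1 + a ^ 2) := by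
      field_simp; ring
    have e3 : 1 - a ^ 2 ≠ 0 := by nlinarith
    rw [e1, hr2, hs2, e2]
    field_simp
    ring
  have toC : ∀ {p : ℝ}, |p| < 1 → ‖(p : ℂ)‖ < 1 := by
    intro p hp
    simpa using hp
  have hu1 : |u| < 1 := by
    have := mb_lt hra (toC hsa)
    rw [mb_real] at this
    simpa only [Complex.norm_real, Real.norm_eq_abs] using this
  have hv1 : |v| < 1 := by
    have := mb_lt hra (toC hsn)
    rw [mb_real] at this
    simpa only [Complex.norm_real, Real.norm_eq_abs] using this
  have hu0 : u ≠ 0 := by rintro h; rw [h] at huv; linarith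
  have hv0 : v ≠ 0 := by rintro h; rw [h] at huv; linarith
  have mu : mb r u = (s : ℂ) := mb_mb hra hsa
  have mv : mb r v = ((-s : ℝ) : ℂ) := mb_mb hra hsn
  have hpow : a ^ ((3 : ℝ) / 2) = r * a := by
    rw [hr, Real.sqrt_eq_rpow, show (3 : ℝ) / 2 = 1 / 2 + 1 by norm_num,
      Real.rpow_add ha0, Real.rpow_one]
  have mem : ∀ w : ℂ, w ∈ unitDisc ↔ ‖w‖ < 1 := by intro w; simp [unitDisc]
  have sq1 : ∀ {w : ℂ}, ‖w‖ < 1 → ‖mb r w ^ 2‖ < 1 := by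
    intro w hw
    rw [norm_pow]
    exact pow_lt_one₀ (norm_nonneg _) (mb_lt hra hw) two_ne_zero
  have fin : ∀ {q : ℂ}, q = ((s ^ 2 : ℝ) : ℂ) → -(mb a q) = (a : ℂ) := by
    rintro q rfl
    rw [mb_real, ← Complex.ofReal_neg, hs2]
    congr 1
    have e2 : 1 - a * (2 * a / (1 + a ^ 2)) = (1 - a ^ 2) / (1 + a ^ 2) := by
      field_simp; ring
    have e3 : 1 - a ^ 2 ≠ 0 := by nlinarith
    rw [e2]
    field_simp
    ring
  set k : ℂ := -γ / ((r * a : ℝ) : ℂ) with hk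
  have hra0 : 0 < r * a := by positivity
  have hk1 : ‖k‖ ≤ 1 := by
    rw [hk, norm_div, norm_neg, Complex.norm_real, Real.norm_of_nonneg hra0.le,
      div_le_one hra0, ← hpow]
    exact hγ
  refine ⟨fun w => -(mb a (mb r w ^ 2)), fun w => k * (mb r w * (mb u w * mb v w)),
    u, r, v, ⟨?_, ?_, ?_, ?_⟩, (mem _).2 (toC hu1), (mem _).2 (toC hra), (mem _).2 (toC hv1),
    ?_, ?_, ?_, ?_, ?_, ?_, ?_, ?_, ?_, ?_⟩
  · intro w hw
    rw [mem] at hw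
    apply DifferentiableAt.differentiableWithinAt
    have h1 := mb_diff hra hw
    exact ((mb_diff haa (sq1 hw)).comp w (h1.pow 2)).neg
  · intro w hw
    rw [mem] at hw
    apply DifferentiableAt.differentiableWithinAt
    exact ((mb_diff hra hw).mul ((mb_diff hu1 hw).mul (mb_diff hv1 hw))).const_mul k
  · intro w hw
    rw [mem] at hw ⊢
    rw [norm_neg]
    exact mb_lt haa (sq1 hw)
  · intro w hw
    rw [mem] at hw ⊢
    rw [norm_mul, norm_mul, norm_mul]
    have h1 := mb_lt hra hw
    have h2 := mb_lt hu1 hw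
    have h3 := mb_lt hv1 hw
    have h4 : ‖mb u w‖ * ‖mb v w‖ ≤ 1 := mul_le_one₀ h2.le (norm_nonneg _) h3.le
    have h5 : ‖mb r w‖ * (‖mb u w‖ * ‖mb v w‖) < 1 :=
      lt_of_le_of_lt (mul_le_of_le_one_right (norm_nonneg _) h4) h1
    exact lt_of_le_of_lt (mul_le_of_le_one_left (by positivity) hk1) h5
  · show -(mb a (mb r 0 ^ 2)) = 0
    rw [mb_zero, ← Complex.ofReal_pow, hr2, mb_self, neg_zero]
  · show k * (mb r 0 * (mb u 0 * mb v 0)) = γ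
    rw [mb_zero, mb_zero, mb_zero, ← Complex.ofReal_mul u v, huv, hk]
    have : (r : ℂ) ≠ 0 := by exact_mod_cast hr0.ne'
    have : (a : ℂ) ≠ 0 := by exact_mod_cast ha0.ne'
    push_cast
    field_simp
  · exact fin (by rw [mu]; push_cast; rfl)
  · simp [mb_self]
  · exact fin (by rw [mv]; push_cast; ring)
  · simp [mb_self]
  · show -(mb a (mb r r ^ 2)) = -(a : ℂ)
    rw [mb_self, zero_pow two_ne_zero, mb_zero]
  · simp [mb_self]
  · have h1 := (mb_diff hra (toC hra)).hasDerivAt.pow 2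
    have h2 := (mb_diff haa (sq1 (toC hra))).hasDerivAt
    have h3 := (HasDerivAt.comp (r : ℂ) h2 h1).neg
    have h4 := h3.deriv
    refine Eq.trans h4 ?_
    simp [mb_self]
  · have hl : ∀ {x : ℝ}, x ≠ 0 → elog ‖(x : ℂ)‖ = ((Real.log x : ℝ) : EReal) := by
      intro x hx
      have : ‖(x : ℂ)‖ ≠ 0 := by simpa using hx
      rw [elog, if_neg this, Complex.norm_real, Real.norm_eq_abs, Real.log_abs]
    rw [hl hu0, hl hv0, hl hr0.ne']
    norm_cast
    rw [← Real.log_mul hu0 hv0, huv, Real.log_neg_eq_log, ← hr2, Real.log_pow]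
    push_cast
    ring
end
end
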